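/- For ρ = 1/2, the classes of the elements z^{i}·u_0 for i ∈ I_k together with the classes of u_j for 0 ≤ j ≤ k form a ℂ-basis of coker(θ_{1/2} : Λ_{1/2} → Λ_{1/2}) = H^1_dR(𝔾_m, L ⊗ Sym^k Ai), where I_k = {1, …, k′+1} if k is odd and I_k = {1, …, k′} if k is even. (These are the classes of the forms ω_i^− = z^{i}u_0 dz/z and η_j^− = u_j dz/z.) -/

import Mathlib

/-- The operator `z·d/dz` on the space `ℤ →₀ ℂ` of Laurent polynomials in `z`
(a Laurent polynomial being recorded by its finitely supported coefficient function,
`single n c` standing for `c·zⁿ`): it multiplies the coefficient of `zⁿ` by `n`. -/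
noncomputable def zdz : (ℤ →₀ ℂ) →ₗ[ℂ] (ℤ →₀ ℂ) :=
  Finsupp.lsum ℂ fun n => (n : ℂ) • Finsupp.lsingle n

/-- Multiplication by `z^m` on Laurent polynomials. -/
noncomputable def shiftT (m : ℤ) : (ℤ →₀ ℂ) →ₗ[ℂ] (ℤ →₀ ℂ) :=
  Finsupp.lmapDomain ℂ ℂ (· + m)

/-- The operator `z∂_z` on `Λ_ρ = ⊕_{a=0}^k ℂ[z,z⁻¹]·u_a`, the module of global sections over
`𝔾_m` of `V_ρ` (where `V_0 = Sym^k Ai` and `V_{1/2} = L ⊗ Sym^k Ai`):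
`θ_ρ(p·u_a) = z·p′·u_a + p·(ρ·u_a + (k−a)·z·u_{a+1} + a·z²·u_{a−1})`. -/
noncomputable def theta (k : ℕ) (ρ : ℂ) :
    (Fin (k + 1) → (ℤ →₀ ℂ)) →ₗ[ℂ] (Fin (k + 1) → (ℤ →₀ ℂ)) :=
  LinearMap.pi fun b =>
    zdz.comp (LinearMap.proj b) + ρ • LinearMap.proj b
    + (if 1 ≤ (b : ℕ) then
        ((k - ((b : ℕ) - 1) : ℕ) : ℂ) •
          (shiftT 1).comp (LinearMap.proj ⟨(b : ℕ) - 1, by have := b.isLt; omega⟩)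
      else 0)
    + (if h : (b : ℕ) + 1 ≤ k then
        (((b : ℕ) + 1 : ℕ) : ℂ) •
          (shiftT 2).comp (LinearMap.proj ⟨(b : ℕ) + 1, by omega⟩)
      else 0)

/-- The element `p·u_a` of `Λ_ρ`. -/
noncomputable def eL (k : ℕ) (a : Fin (k + 1)) (p : ℤ →₀ ℂ) : Fin (k + 1) → (ℤ →₀ ℂ) :=
  fun b => if b = a then p else 0

/-- The family of classes `z·u_0, …, z^m·u_0, u_0, u_1, …, u_k` in
`H¹_dR(𝔾_m, V_ρ) = coker(θ_ρ : Λ_ρ → Λ_ρ)`. -/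
noncomputable def famL (k m : ℕ) (ρ : ℂ) :
    (Fin m ⊕ Fin (k + 1)) → ((Fin (k + 1) → (ℤ →₀ ℂ)) ⧸ LinearMap.range (theta k ρ)) :=
  Sum.elim
    (fun i => Submodule.Quotient.mk (eL k 0 (Finsupp.single ((i : ℕ) + 1 : ℤ) 1)))
    (fun j => Submodule.Quotient.mk (eL k j (Finsupp.single 0 1)))

/-- A family of numbers whose consecutive terms are related by nonzero ratios of sign `-1` is,
up to positive factors, an alternating multiple of its first term. -/
theorem alternating_of_recurrence {x : ℕ → ℂ} {q : ℕ} (α β : ℕ → ℝ)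
    (hα : ∀ j < q, 0 < α j) (hβ : ∀ j < q, 0 < β j)
    (h : ∀ j < q, (α j : ℂ) * x j + (β j : ℂ) * x (j + 1) = 0) (j : ℕ) (hj : j ≤ q) :
    ∃ p : ℝ, 0 < p ∧ x j = (-1) ^ j * p * x 0 := by
  induction j with
  | zero => exact ⟨1, one_pos, by simp⟩
  | succ j ih =>
    obtain ⟨p, hp, hx⟩ := ih (by omega)
    have hβ0 : (β j : ℂ) ≠ 0 := by exact_mod_cast (hβ j hj).ne'
    refine ⟨α j * p / β j, div_pos (mul_pos (hα j hj) hp) (hβ j hj), ?_⟩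
    have := h j hj
    rw [hx] at this
    push_cast
    field_simp
    linear_combination this

/-- The inhomogeneous variant of `alternating_of_recurrence`. -/
theorem alternating_of_recurrence_add {x w : ℕ → ℂ} {q : ℕ} (α β δ : ℕ → ℝ)
    (hα : ∀ j < q, 0 < α j) (hβ : ∀ j < q, 0 < β j) (hδ : ∀ j < q, 0 ≤ δ j) (hδ0 : 0 < δ 0)
    (hx : ∀ j < q, ∃ p : ℝ, 0 ≤ p ∧ x j = (-1) ^ j * p * x 0)
    (h0 : 0 < q → (δ 0 : ℂ) * x 0 + (β 0 : ℂ) * w 0 = 0)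
    (h : ∀ j, j + 1 < q →
      (δ (j + 1) : ℂ) * x (j + 1) + (α j : ℂ) * w j + (β (j + 1) : ℂ) * w (j + 1) = 0)
    (j : ℕ) (hj : j < q) :
    ∃ t : ℝ, 0 < t ∧ w j = (-1) ^ (j + 1) * t * x 0 := by
  induction j with
  | zero =>
    have hβ0 : (β 0 : ℂ) ≠ 0 := by exact_mod_cast (hβ 0 hj).ne'
    refine ⟨δ 0 / β 0, div_pos hδ0 (hβ 0 hj), ?_⟩
    push_cast
    field_simp
    linear_combination h0 hj
  | succ j ih =>
    obtain ⟨t, ht, hw⟩ := ih (by omega)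
    obtain ⟨p, hp, hxp⟩ := hx (j + 1) hj
    have hβ0 : (β (j + 1) : ℂ) ≠ 0 := by exact_mod_cast (hβ _ hj).ne'
    refine ⟨(δ (j + 1) * p + α j * t) / β (j + 1),
      div_pos (add_pos_of_nonneg_of_pos (mul_nonneg (hδ _ hj) hp)
        (mul_pos (hα j (by omega)) ht)) (hβ _ hj), ?_⟩
    have := h j hj
    rw [hw, hxp] at this
    push_cast
    field_simp
    linear_combination this

theorem intCast_add_half_ne_zero (n : ℤ) : (n : ℂ) + 1 / 2 ≠ 0 := by
  intro h
  have h2 : ((2 * n + 1 : ℤ) : ℂ) = 0 := by push_cast; linear_combination 2 * h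
  have := Int.cast_eq_zero.1 h2
  omega

/-- The coefficients of a form whose image under `θ` is supported at `z⁰` and at
`z u_0, …, z^m u_0`: `f a n` is the coefficient of `zⁿ u_a`. -/
structure IsRelation (k m : ℕ) (f : ℕ → ℤ → ℂ) : Prop where
  eq_zero_of_lt : ∀ (a : ℕ) (n : ℤ), k < a → f a n = 0
  neg : ∀ (a : ℕ) (n : ℤ), n < 0 → f a n = 0
  zero : ∀ n : ℤ, 0 < n → (m : ℤ) < n → ((n : ℂ) + 1 / 2) * f 0 n + f 1 (n - 2) = 0
  succ : ∀ (a : ℕ) (n : ℤ), a + 1 ≤ k → 0 < n →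
    ((n : ℂ) + 1 / 2) * f (a + 1) n + ((k : ℂ) - a) * f a (n - 1)
      + ((a : ℂ) + 2) * f (a + 2) (n - 2) = 0

namespace IsRelation

variable {k m : ℕ} {f : ℕ → ℤ → ℂ}

/-- The leading term of a relation is killed by the leading part of `θ`. -/
theorem top (hf : IsRelation k m f) {e : ℤ} (he : ∀ (a : ℕ) (n : ℤ), e < 2 * n + a → f a n = 0)
    (a : ℕ) (n : ℤ) (ha : a + 1 ≤ k) (hn : 2 * n + a = e) :
    ((k : ℂ) - a) * f a n + ((a : ℂ) + 2) * f (a + 2) (n - 1) = 0 := by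
  rcases lt_or_ge n 0 with h | h
  · rw [hf.neg a n h, hf.neg (a + 2) (n - 1) (by omega)]; ring
  · have h1 := hf.succ a (n + 1) ha (by omega)
    rw [he (a + 1) (n + 1) (by push_cast; omega), show n + 1 - 1 = n by ring,
      show n + 1 - 2 = n - 1 by ring] at h1
    linear_combination h1

/-- If the leading part of `θ` relates the leading coefficients down from `u_{k+1}`,
they all vanish. -/
theorem top_eq_zero_of_add_eq (hf : IsRelation k m f) {e : ℤ}
    (he : ∀ (a : ℕ) (n : ℤ), e < 2 * n + a → f a n = 0) (d : ℕ) (a : ℕ) (n : ℤ) (ha : a + 2 * d = k + 1)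
    (hn : 2 * n + a = e) : f a n = 0 := by
  induction d generalizing a n with
  | zero => exact hf.eq_zero_of_lt a n (by omega)
  | succ d ih =>
    have h := hf.top he a n (by omega) hn
    rw [ih (a + 2) (n - 1) (by omega) (by push_cast; omega), mul_zero, add_zero] at h
    refine (mul_eq_zero.1 h).resolve_left fun h0 => ?_
    have : k = a := by exact_mod_cast sub_eq_zero.1 h0
    omega

/-- If the leading part of `θ` relates the leading coefficients up to `u_k`,
they alternate in sign. -/
theorem top_alternating (hf : IsRelation k m f) {e : ℤ}
    (he : ∀ (a : ℕ) (n : ℤ), e < 2 * n + a → f a n = 0) (r q : ℕ) (c : ℤ) (hk : k = 2 * q + r)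
    (hc : 2 * c + r = e) (j : ℕ) (hj : j ≤ q) :
    ∃ p : ℝ, 0 < p ∧ f (2 * j + r) (c - j) = (-1) ^ j * p * f r c := by
  have := alternating_of_recurrence (x := fun j : ℕ => f (2 * j + r) (c - j)) (q := q)
    (fun j => 2 * (q - j)) (fun j => 2 * j + r + 2)
    (fun j hj => by
      have : (j : ℝ) < q := by exact_mod_cast hj
      linarith)
    (fun j _ => by positivity)
    (fun j hj => by
      have h := hf.top he (2 * j + r) (c - j) (by omega) (by push_cast; omega)
      have e1 : 2 * (j + 1) + r = 2 * j + r + 2 := by ring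
      have e2 : c - ((j + 1 : ℕ) : ℤ) = c - j - 1 := by push_cast; ring
      simp only [e1, e2]
      rw [hk] at h
      push_cast at h ⊢
      linear_combination h) j hj
  simpa using this

theorem top_eq_zero_of_odd (q : ℕ) (hk : k = 2 * q + 1) (hm : m = q + 1)
    (hf : IsRelation k m f) {e : ℤ} (he : ∀ (a : ℕ) (n : ℤ), e < 2 * n + a → f a n = 0)
    (a : ℕ) (n : ℤ) (hn : 2 * n + a = e) : f a n = 0 := by
  rcases lt_or_ge k a with hak | hak
  · exact hf.eq_zero_of_lt a n hak
  rcases Nat.even_or_odd' a with ⟨j, rfl | rfl⟩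
  · exact hf.top_eq_zero_of_add_eq he (q + 1 - j) _ n (by omega) hn
  · have alt := hf.top_alternating he 1 q (n + j) hk (by push_cast at hn ⊢; omega)
    have h1 : f 1 (n + j) = 0 := by
      by_cases hc : n + j + 2 ≤ m
      · obtain ⟨p, hp, h⟩ := alt q le_rfl
        rw [hf.neg _ _ (by omega)] at h
        simpa [hp.ne'] using h.symm
      · rcases lt_or_ge (n + j) 0 with h | h
        · exact hf.neg _ _ h
        · have := hf.zero (n + j + 2) (by omega) (by omega)
          rw [he 0 (n + j + 2) (by push_cast at hn ⊢; omega)] at this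
          simpa using this
    obtain ⟨p, hp, h⟩ := alt j (by omega)
    simpa [h1] using h

theorem top_eq_zero_of_even (q : ℕ) (hk : k = 2 * q) (hm : m + 1 = q)
    (hf : IsRelation k m f) {e : ℤ} (he : ∀ (a : ℕ) (n : ℤ), e < 2 * n + a → f a n = 0)
    (a : ℕ) (n : ℤ) (hn : 2 * n + a = e) : f a n = 0 := by
  rcases lt_or_ge k a with hak | hak
  · exact hf.eq_zero_of_lt a n hak
  rcases Nat.even_or_odd' a with ⟨j, rfl | rfl⟩
  swap
  · exact hf.top_eq_zero_of_add_eq he (q - j) _ n (by omega) hn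
  obtain ⟨c, hc⟩ : ∃ c, c = n + j := ⟨_, rfl⟩
  have alt := hf.top_alternating he 0 q c hk (by push_cast at hn ⊢; omega)
  simp only [add_zero] at alt
  suffices h0 : f 0 c = 0 by
    obtain ⟨p, hp, h⟩ := alt j (by omega)
    rw [h0, mul_zero, hc, add_sub_cancel_right] at h
    exact h
  by_contra h0
  obtain ⟨p, hp, hxq⟩ := alt q le_rfl
  have hcq : (q : ℤ) ≤ c := by
    by_contra hlt
    rw [hf.neg _ _ (by omega)] at hxq
    exact h0 (by simpa [hp.ne'] using hxq.symm)
  have second (i : ℕ) (hi : i + 1 ≤ q) (hic : ((i + 1 : ℕ) : ℤ) < c) :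
      ((c : ℂ) - (i + 1) + 1 / 2) * f (2 * (i + 1)) (c - (i + 1 : ℕ))
        + ((k : ℂ) - 2 * i - 1) * f (2 * i + 1) (c - i - 2)
        + (2 * (i : ℂ) + 3) * f (2 * (i + 1) + 1) (c - (i + 1 : ℕ) - 2) = 0 := by
    have h := hf.succ (2 * i + 1) (c - (i + 1 : ℕ)) (by omega) (by omega)
    have e1 : c - ((i + 1 : ℕ) : ℤ) - 1 = c - i - 2 := by push_cast; ring
    rw [e1, show 2 * i + 1 + 1 = 2 * (i + 1) by ring,
      show 2 * i + 1 + 2 = 2 * (i + 1) + 1 by ring] at h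
    push_cast at h ⊢
    linear_combination h
  have hcR : (q : ℝ) ≤ c := by exact_mod_cast hcq
  have walt := alternating_of_recurrence_add (x := fun i : ℕ => f (2 * i) (c - i))
    (w := fun i : ℕ => f (2 * i + 1) (c - i - 2)) (q := q)
    (fun i => k - 2 * i - 1) (fun i => 2 * i + 1) (fun i => c - i + 1 / 2)
    (fun i hi => by
      have : (2 * i + 1 : ℝ) < k := by exact_mod_cast (by omega : 2 * i + 1 < k)
      linarith)
    (fun i _ => by positivity)
    (fun i hi => by
      have : (i : ℝ) ≤ q := by exact_mod_cast hi.le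
      linarith)
    (by have : (0 : ℝ) ≤ q := by positivity
        push_cast
        linarith)
    (fun i hi => by
      obtain ⟨p, hp, h⟩ := alt i hi.le
      exact ⟨p, hp.le, by simpa using h⟩)
    (fun hq => by
      have h := hf.zero c (by omega) (by omega)
      simpa using h)
    (fun i hi => by
      have h := second i hi.le (by omega)
      push_cast at h ⊢
      linear_combination h)
  obtain ⟨t, ht, hw⟩ := walt m (by omega)
  simp only [mul_zero, Nat.cast_zero, sub_zero] at hw
  subst hm
  rcases hcq.eq_or_lt with hcq | hcq
  · rw [hf.neg _ _ (by push_cast at hcq; omega)] at hw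
    exact h0 (by simpa [ht.ne'] using hw.symm)
  · have h := second m le_rfl hcq
    rw [hf.eq_zero_of_lt _ (c - (m + 1 : ℕ) - 2) (by omega), hw, hxq, hk] at h
    have h' : (-1 : ℂ) ^ (m + 1) * (((c - (m + 1) + 1 / 2) * p + t : ℝ) : ℂ) * f 0 c = 0 := by
      push_cast at h ⊢
      linear_combination h
    have hpos : 0 < ((c : ℝ) - (m + 1) + 1 / 2) * p + t := by
      push_cast at hcR
      have : 0 < ((c : ℝ) - (m + 1) + 1 / 2) := by linarith
      positivity
    have hne : ((((c : ℝ) - (m + 1) + 1 / 2) * p + t : ℝ) : ℂ) ≠ 0 := by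
      exact_mod_cast hpos.ne'
    exact mul_ne_zero (mul_ne_zero (pow_ne_zero _ (by norm_num)) hne) h0 h'

theorem eq_zero (q : ℕ) (hkm : (k = 2 * q + 1 ∧ m = q + 1) ∨ (k = 2 * q ∧ m + 1 = q))
    (hf : IsRelation k m f) (N : ℤ) (hN : ∀ (a : ℕ) (n : ℤ), N < n → f a n = 0) (a : ℕ) (n : ℤ) :
    f a n = 0 := by
  have key (t : ℕ) : ∀ (a : ℕ) (n : ℤ), 2 * N + k - t < 2 * n + a → f a n = 0 := by
    induction t with
    | zero =>
      intro a n h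
      rcases lt_or_ge k a with hak | hak
      · exact hf.eq_zero_of_lt a n hak
      · exact hN a n (by push_cast at h; omega)
    | succ t ih =>
      intro a n h
      rcases lt_or_ge (2 * N + k - t) (2 * n + a) with h' | h'
      · exact ih a n h'
      · have hn : 2 * n + a = 2 * N + k - t := by push_cast at h; omega
        rcases hkm with ⟨hk, hm⟩ | ⟨hk, hm⟩
        · exact top_eq_zero_of_odd q hk hm hf ih a n hn
        · exact top_eq_zero_of_even q hk hm hf ih a n hn
  rcases lt_or_ge n 0 with h | h
  · exact hf.neg a n h
  · exact key (2 * N + k + 1).toNat a n (by omega)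

end IsRelation

/-- The values `g a n` at `zⁿ u_a` of a linear functional that vanishes on the image of `θ` and
on `u_0, …, u_k, z u_0, …, z^m u_0`. -/
structure IsCorelation (k m : ℕ) (g : ℕ → ℤ → ℂ) : Prop where
  eq_zero_of_lt : ∀ (a : ℕ) (n : ℤ), k < a → g a n = 0
  zero : ∀ n : ℤ, ((n : ℂ) + 1 / 2) * g 0 n + (k : ℂ) * g 1 (n + 1) = 0
  succ : ∀ (a : ℕ) (n : ℤ), a + 1 ≤ k →
    ((n : ℂ) + 1 / 2) * g (a + 1) n + ((k : ℂ) - a - 1) * g (a + 2) (n + 1)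
      + ((a : ℂ) + 1) * g a (n + 2) = 0
  const : ∀ a, g a 0 = 0
  low : ∀ n : ℤ, 0 ≤ n → n ≤ m → g 0 n = 0

namespace IsCorelation

variable {k m : ℕ} {g : ℕ → ℤ → ℂ}

theorem odd_eq_zero (hg : IsCorelation k m g) {e : ℤ}
    (he : ∀ (a : ℕ) (n : ℤ), 0 ≤ n → 2 * n + a < e → g a n = 0) (j : ℕ) (n : ℤ) (hn0 : 0 ≤ n)
    (hn : 2 * n + (2 * j + 1 : ℕ) = e) : g (2 * j + 1) n = 0 := by
  induction j generalizing n with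
  | zero =>
    rcases Nat.eq_zero_or_pos k with hk | hk
    · exact hg.eq_zero_of_lt _ _ (by omega)
    rcases hn0.eq_or_lt with rfl | hn1
    · exact hg.const _
    have h := hg.zero (n - 1)
    rw [he 0 (n - 1) (by omega) (by push_cast at hn ⊢; omega), sub_add_cancel] at h
    simpa [hk.ne'] using h
  | succ j ih =>
    rcases lt_or_ge k (2 * (j + 1) + 1) with hk | hk
    · exact hg.eq_zero_of_lt _ _ hk
    rcases hn0.eq_or_lt with rfl | hn1
    · exact hg.const _
    have h := hg.succ (2 * j + 1) (n - 1) (by omega)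
    rw [he _ (n - 1) (by omega) (by push_cast at hn ⊢; omega), sub_add_cancel,
      show n - 1 + 2 = n + 1 by ring,
      ih (n + 1) (by omega) (by push_cast at hn ⊢; omega), mul_zero, mul_zero, zero_add,
      add_zero] at h
    refine (mul_eq_zero.1 h).resolve_left fun h0 => ?_
    have : k = 2 * j + 1 + 1 := by
      have : (k : ℂ) = ((2 * j + 1 + 1 : ℕ) : ℂ) := by
        push_cast at h0 ⊢
        linear_combination h0
      exact_mod_cast this
    omega

/-- In a fixed degree, and up to lower degrees, the classes of `z^{c-j} u_{2j}` are alternating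
multiples of that of `z^c u_0`. -/
theorem even_alternating (hg : IsCorelation k m g) {c : ℤ}
    (he : ∀ (a : ℕ) (n : ℤ), 0 ≤ n → 2 * n + a < 2 * c → g a n = 0) (j : ℕ) (hjk : 2 * j ≤ k)
    (hjc : (j : ℤ) < c ∨ j = 0) :
    ∃ p : ℝ, 0 < p ∧ g (2 * j) (c - j) = (-1) ^ j * p * g 0 c := by
  have := alternating_of_recurrence (x := fun j : ℕ => g (2 * j) (c - j)) (q := j)
    (fun i => 2 * i + 1) (fun i => k - 2 * i - 1) (fun i _ => by positivity)
    (fun i hi => by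
      have : (2 * i + 1 : ℝ) < k := by exact_mod_cast (by omega : 2 * i + 1 < k)
      linarith)
    (fun i hi => by
      have h := hg.succ (2 * i) (c - i - 2) (by omega)
      rw [he (2 * i + 1) (c - i - 2) (by omega) (by push_cast; omega),
        sub_add_cancel, show c - i - 2 + 1 = c - ((i + 1 : ℕ) : ℤ) by push_cast; ring,
        show 2 * i + 2 = 2 * (i + 1) by ring] at h
      push_cast at h ⊢
      linear_combination h) j le_rfl
  simpa using this

theorem zero_eq_zero_of_odd (q : ℕ) (hk : k = 2 * q + 1) (hm : m = q + 1)
    (hg : IsCorelation k m g) {c : ℤ} (hc : 0 ≤ c)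
    (he : ∀ (a : ℕ) (n : ℤ), 0 ≤ n → 2 * n + a < 2 * c → g a n = 0) : g 0 c = 0 := by
  rcases le_or_gt c m with h | h
  · exact hg.low c hc h
  obtain ⟨p, hp, hx⟩ := hg.even_alternating he q (by omega) (.inl (by omega))
  have h := hg.succ (2 * q) (c - q - 2) (by omega)
  rw [he (2 * q + 1) (c - q - 2) (by omega) (by push_cast; omega), sub_add_cancel,
    hg.eq_zero_of_lt (2 * q + 2) _ (by omega), hx, mul_zero, mul_zero, zero_add, zero_add] at h
  have : (2 * (q : ℂ) + 1) ≠ 0 := by exact_mod_cast (by omega : 2 * q + 1 ≠ 0)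
  simpa [hp.ne', this] using h

theorem zero_eq_zero_of_even (q : ℕ) (hk : k = 2 * q) (hm : m + 1 = q)
    (hg : IsCorelation k m g) {c : ℤ} (hc : 0 ≤ c)
    (he : ∀ (a : ℕ) (n : ℤ), 0 ≤ n → 2 * n + a < 2 * c → g a n = 0) : g 0 c = 0 := by
  rcases le_or_gt c m with h | hmc
  · exact hg.low c hc h
  have hcR : (q : ℝ) ≤ c := by exact_mod_cast (by omega : (q : ℤ) ≤ c)
  have second (i : ℕ) (hi : i + 1 ≤ q) :
      ((c : ℂ) - (i + 1) + 1 / 2) * g (2 * (i + 1)) (c - (i + 1 : ℕ))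
        + (2 * (i : ℂ) + 2) * g (2 * i + 1) (c - i + 1)
        + ((k : ℂ) - 2 * i - 2) * g (2 * (i + 1) + 1) (c - (i + 1 : ℕ) + 1) = 0 := by
    have h := hg.succ (2 * i + 1) (c - (i + 1 : ℕ)) (by omega)
    have e1 : c - ((i + 1 : ℕ) : ℤ) + 2 = c - i + 1 := by push_cast; ring
    rw [e1, show 2 * i + 1 + 1 = 2 * (i + 1) by ring,
      show 2 * i + 1 + 2 = 2 * (i + 1) + 1 by ring] at h
    push_cast at h ⊢
    linear_combination h
  obtain ⟨t, ht, hw⟩ := alternating_of_recurrence_add (x := fun i : ℕ => g (2 * i) (c - i))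
    (w := fun i : ℕ => g (2 * i + 1) (c - i + 1)) (q := q)
    (fun i => 2 * i + 2) (fun i => k - 2 * i) (fun i => c - i + 1 / 2)
    (fun i _ => by positivity)
    (fun i hi => by
      have : (2 * i : ℝ) < k := by exact_mod_cast (by omega : 2 * i < k)
      linarith)
    (fun i hi => by
      have : (i : ℝ) ≤ q := by exact_mod_cast hi.le
      linarith)
    (by have : (0 : ℝ) ≤ q := by positivity
        push_cast
        linarith)
    (fun i hi => by
      obtain ⟨p, hp, h⟩ := hg.even_alternating he i (by omega) (by omega)
      exact ⟨p, hp.le, by simpa using h⟩)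
    (fun _ => by
      have h := hg.zero c
      simpa using h)
    (fun i hi => by
      have h := second i hi.le
      push_cast at h ⊢
      linear_combination h) m (by omega)
  simp only [mul_zero, Nat.cast_zero, sub_zero] at hw
  subst hm
  obtain ⟨p, hp, hxq⟩ : ∃ p : ℝ, 0 ≤ p ∧
      g (2 * (m + 1)) (c - (m + 1 : ℕ)) = (-1) ^ (m + 1) * p * g 0 c := by
    by_cases hcm : ((m + 1 : ℕ) : ℤ) < c
    · obtain ⟨p, hp, h⟩ := hg.even_alternating he (m + 1) hk.ge (.inl hcm)
      exact ⟨p, hp.le, h⟩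
    · refine ⟨0, le_rfl, ?_⟩
      rw [show c - ((m + 1 : ℕ) : ℤ) = 0 by omega, hg.const]
      simp
  have h := second m le_rfl
  rw [hg.eq_zero_of_lt _ (c - (m + 1 : ℕ) + 1) (by omega), hw, hxq] at h
  have h' : (-1 : ℂ) ^ (m + 1) * (((c - (m + 1) + 1 / 2) * p + (2 * m + 2) * t : ℝ) : ℂ)
      * g 0 c = 0 := by
    push_cast at h ⊢
    linear_combination h
  have hpos : 0 < ((c : ℝ) - (m + 1) + 1 / 2) * p + (2 * m + 2) * t := by
    push_cast at hcR
    have : 0 < ((c : ℝ) - (m + 1) + 1 / 2) := by linarith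
    positivity
  have hne : ((((c : ℝ) - (m + 1) + 1 / 2) * p + (2 * m + 2) * t : ℝ) : ℂ) ≠ 0 := by
    exact_mod_cast hpos.ne'
  exact (mul_eq_zero.1 h').resolve_left
    (mul_ne_zero (pow_ne_zero _ (by norm_num)) hne)

theorem eq_zero (q : ℕ) (hkm : (k = 2 * q + 1 ∧ m = q + 1) ∨ (k = 2 * q ∧ m + 1 = q))
    (hg : IsCorelation k m g) (a : ℕ) (n : ℤ) : g a n = 0 := by
  have key (t : ℕ) : ∀ (a : ℕ) (n : ℤ), 0 ≤ n → 2 * n + a < t → g a n = 0 := by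
    induction t with
    | zero => intro a n h0 h; push_cast at h; omega
    | succ t ih =>
      intro a n hn0 h
      rcases lt_or_ge (2 * n + a) (t : ℤ) with h' | h'
      · exact ih a n hn0 h'
      have hn : 2 * n + a = t := by push_cast at h; omega
      rcases lt_or_ge k a with hak | hak
      · exact hg.eq_zero_of_lt a n hak
      rcases Nat.even_or_odd' a with ⟨j, rfl | rfl⟩
      · obtain ⟨c, rfl⟩ : ∃ c, n = c - j := ⟨n + j, by ring⟩
        have he : ∀ (a : ℕ) (n : ℤ), 0 ≤ n → 2 * n + a < 2 * c → g a n = 0 := fun a n h0 h1 =>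
          ih a n h0 (by push_cast at hn; omega)
        rcases hn0.eq_or_lt with h0 | h0
        · rw [← h0, hg.const]
        obtain ⟨p, -, h⟩ := hg.even_alternating he j hak (.inl (by omega))
        rw [h]
        rcases hkm with ⟨hk, hm⟩ | ⟨hk, hm⟩
        · rw [zero_eq_zero_of_odd q hk hm hg (by omega) he, mul_zero]
        · rw [zero_eq_zero_of_even q hk hm hg (by omega) he, mul_zero]
      · exact hg.odd_eq_zero ih j n hn0 hn
  have low (t : ℕ) : ∀ a (n : ℤ), -t ≤ n → g a n = 0 := by
    induction t with
    | zero => exact fun a n h => key (2 * n + a + 1).toNat a n (by omega) (by omega)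
    | succ t ih =>
      intro a n h
      rcases lt_or_ge k a with hak | hak
      · exact hg.eq_zero_of_lt a n hak
      by_cases h' : -(t : ℤ) ≤ n
      · exact ih a n h'
      push_cast at h
      refine (mul_eq_zero.1 (?_ : ((n : ℂ) + 1 / 2) * g a n = 0)).resolve_left
        (intCast_add_half_ne_zero n)
      rcases a with _ | a
      · have := hg.zero n
        rw [ih 1 (n + 1) (by omega)] at this
        linear_combination this
      · have := hg.succ a n hak
        rw [ih (a + 2) (n + 1) (by omega), ih a (n + 2) (by omega)] at this
        linear_combination this
  exact low (-n).toNat a n (by omega)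

end IsCorelation

section Laurent

variable {k m : ℕ}

/-- The coefficient of `zⁿ u_a` (zero if `a > k`). -/
noncomputable def lcoeff (y : Fin (k + 1) → (ℤ →₀ ℂ)) (a : ℕ) (n : ℤ) : ℂ :=
  if h : a < k + 1 then y ⟨a, h⟩ n else 0

/-- The element `zⁿ u_a` of `Λ_ρ` (zero if `a > k`). -/
noncomputable def lmonomial (k a : ℕ) (n : ℤ) : Fin (k + 1) → (ℤ →₀ ℂ) :=
  if h : a < k + 1 then eL k ⟨a, h⟩ (Finsupp.single n 1) else 0

theorem lcoeff_of_lt (y : Fin (k + 1) → (ℤ →₀ ℂ)) {a : ℕ} (h : k < a) (n : ℤ) :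
    lcoeff y a n = 0 :=
  dif_neg (by omega)

theorem lcoeff_ext {y w : Fin (k + 1) → (ℤ →₀ ℂ)}
    (h : ∀ (a : ℕ) (n : ℤ), a ≤ k → lcoeff y a n = lcoeff w a n) : y = w := by
  ext b n
  simpa [lcoeff, b.2] using h b n (by omega)

theorem lcoeff_add (y w : Fin (k + 1) → (ℤ →₀ ℂ)) (a : ℕ) (n : ℤ) :
    lcoeff (y + w) a n = lcoeff y a n + lcoeff w a n := by
  unfold lcoeff; split_ifs <;> simp

theorem lcoeff_smul (c : ℂ) (y : Fin (k + 1) → (ℤ →₀ ℂ)) (a : ℕ) (n : ℤ) :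
    lcoeff (c • y) a n = c * lcoeff y a n := by
  unfold lcoeff; split_ifs <;> simp

theorem lcoeff_sum {ι : Type*} (s : Finset ι) (y : ι → Fin (k + 1) → (ℤ →₀ ℂ)) (a : ℕ) (n : ℤ) :
    lcoeff (∑ i ∈ s, y i) a n = ∑ i ∈ s, lcoeff (y i) a n := by
  unfold lcoeff; split_ifs <;> simp

theorem lcoeff_lmonomial (a b : ℕ) (n l : ℤ) (hb : b ≤ k) :
    lcoeff (lmonomial k a n) b l = if a = b ∧ n = l then 1 else 0 := by
  unfold lcoeff lmonomial eL
  rw [dif_pos (by omega)]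
  by_cases ha : a < k + 1
  · by_cases hab : a = b
    · subst hab; simp [ha, Finsupp.single_apply]
    · simp [ha, hab, Ne.symm hab]
  · have hab : a ≠ b := by omega
    simp [ha, hab]

theorem zdz_apply (p : ℤ →₀ ℂ) (n : ℤ) : zdz p n = n * p n := by
  induction p using Finsupp.induction_linear with
  | zero => simp
  | add p q hp hq => simp [hp, hq, mul_add]
  | single l c =>
    by_cases h : l = n
    · subst h; simp [zdz]
    · simp [zdz, h]

theorem shiftT_apply (l : ℤ) (p : ℤ →₀ ℂ) (n : ℤ) : shiftT l p n = p (n - l) := by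
  have h := Finsupp.mapDomain_apply (add_left_injective l) p (n - l)
  simpa [shiftT] using h

theorem lcoeff_theta_zero (ρ : ℂ) (y : Fin (k + 1) → (ℤ →₀ ℂ)) (n : ℤ) :
    lcoeff (theta k ρ y) 0 n = ((n : ℂ) + ρ) * lcoeff y 0 n + lcoeff y 1 (n - 2) := by
  by_cases hk : 0 < k
  · simp [lcoeff, theta, zdz_apply, shiftT_apply, hk]; ring
  · have : k = 0 := by omega
    simp [lcoeff, theta, zdz_apply, this]; ring

theorem lcoeff_theta_succ (ρ : ℂ) (y : Fin (k + 1) → (ℤ →₀ ℂ)) (a : ℕ) (n : ℤ)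
    (ha : a + 1 ≤ k) :
    lcoeff (theta k ρ y) (a + 1) n = ((n : ℂ) + ρ) * lcoeff y (a + 1) n
      + ((k : ℂ) - a) * lcoeff y a (n - 1) + ((a : ℂ) + 2) * lcoeff y (a + 2) (n - 2) := by
  have ha0 : a < k + 1 := by omega
  have ha1 : a + 1 < k + 1 := by omega
  by_cases ha2 : a + 2 < k + 1
  · have ha2' : a + 1 < k := by omega
    simp [lcoeff, theta, zdz_apply, shiftT_apply, ha0, ha1, ha2, ha2']
    ring
  · have ha2' : ¬ a + 1 < k := by omega
    simp [lcoeff, theta, zdz_apply, shiftT_apply, ha0, ha1, ha2, ha2']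
    ring

theorem theta_lmonomial_zero (ρ : ℂ) (n : ℤ) :
    theta k ρ (lmonomial k 0 n) = ((n : ℂ) + ρ) • lmonomial k 0 n
      + (k : ℂ) • lmonomial k 1 (n + 1) := by
  refine lcoeff_ext fun b l hb => ?_
  rcases b with _ | b
  · rw [lcoeff_theta_zero]
    rcases Nat.eq_zero_or_pos k with rfl | hk
    · rw [lcoeff_of_lt _ Nat.zero_lt_one]
      simp only [lcoeff_add, lcoeff_smul, lcoeff_lmonomial _ _ _ _ hb]
      grind
    · simp only [lcoeff_add, lcoeff_smul, lcoeff_lmonomial _ _ _ _ hb,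
        lcoeff_lmonomial _ _ _ _ hk]
      grind
  · have hcast : b = 0 → (b : ℂ) = 0 := by rintro rfl; simp
    rw [lcoeff_theta_succ _ _ _ _ hb]
    rcases lt_or_ge k (b + 2) with hk | hk
    · rw [lcoeff_of_lt _ hk]
      simp only [lcoeff_add, lcoeff_smul, lcoeff_lmonomial _ _ _ _ hb,
        lcoeff_lmonomial _ _ _ _ (show b ≤ k by omega)]
      grind
    · simp only [lcoeff_add, lcoeff_smul, lcoeff_lmonomial _ _ _ _ hb,
        lcoeff_lmonomial _ _ _ _ (show b ≤ k by omega), lcoeff_lmonomial _ _ _ _ hk]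
      grind

theorem theta_lmonomial_succ (ρ : ℂ) (a : ℕ) (n : ℤ) (ha : a + 1 ≤ k) :
    theta k ρ (lmonomial k (a + 1) n) = ((n : ℂ) + ρ) • lmonomial k (a + 1) n
      + ((k : ℂ) - a - 1) • lmonomial k (a + 2) (n + 1)
      + ((a : ℂ) + 1) • lmonomial k a (n + 2) := by
  refine lcoeff_ext fun b l hb => ?_
  rcases b with _ | b
  · have hcast : a = 0 → (a : ℂ) = 0 := by rintro rfl; simp
    rw [lcoeff_theta_zero]
    simp only [lcoeff_add, lcoeff_smul, lcoeff_lmonomial _ _ _ _ hb,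
        lcoeff_lmonomial _ _ _ _ (show 1 ≤ k by omega)]
    grind
  · have hcast : a + 1 = b → (b : ℂ) = a + 1 := by rintro rfl; simp
    have hcast' : a = b + 1 → (a : ℂ) = b + 1 := by rintro rfl; simp
    rw [lcoeff_theta_succ _ _ _ _ hb]
    rcases lt_or_ge k (b + 2) with hk | hk
    · rw [lcoeff_of_lt _ hk]
      simp only [lcoeff_add, lcoeff_smul, lcoeff_lmonomial _ _ _ _ hb,
        lcoeff_lmonomial _ _ _ _ (show b ≤ k by omega)]
      grind
    · simp only [lcoeff_add, lcoeff_smul, lcoeff_lmonomial _ _ _ _ hb,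
        lcoeff_lmonomial _ _ _ _ (show b ≤ k by omega), lcoeff_lmonomial _ _ _ _ hk]
      grind

theorem exists_lcoeff_support_bound (y : Fin (k + 1) → (ℤ →₀ ℂ)) :
    ∃ N : ℤ, ∀ (a : ℕ) (n : ℤ), N < |n| → lcoeff y a n = 0 := by
  obtain ⟨N, hN⟩ := ((Finset.univ.biUnion fun b => (y b).support).image abs).bddAbove
  refine ⟨N, fun a n hn => ?_⟩
  unfold lcoeff
  split_ifs with ha
  · by_contra h
    have : |n| ≤ N := hN (by
      simp only [Finset.coe_image, Set.mem_image, Finset.mem_coe, Finset.mem_biUnion]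
      exact ⟨n, ⟨⟨a, ha⟩, Finset.mem_univ _, Finsupp.mem_support_iff.2 h⟩, rfl⟩)
    omega
  · rfl

/-- If `θ_{1/2} y` has no negative powers of `z`, neither has `y`. -/
theorem lcoeff_eq_zero_of_neg (y : Fin (k + 1) → (ℤ →₀ ℂ))
    (h : ∀ (a : ℕ) (n : ℤ), n < 0 → lcoeff (theta k (1 / 2) y) a n = 0) (a : ℕ) (n : ℤ)
    (hn : n < 0) : lcoeff y a n = 0 := by
  obtain ⟨N, hN⟩ := exists_lcoeff_support_bound y
  have key (t : ℕ) : ∀ (a : ℕ) (n : ℤ), n < 0 → n < -N + t → lcoeff y a n = 0 := by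
    induction t with
    | zero =>
      intro a n hn hlt
      exact hN a n (by rw [abs_of_neg hn]; push_cast at hlt; omega)
    | succ t ih =>
      intro a n hn hlt
      push_cast at hlt
      rcases lt_or_ge k a with hak | hak
      · exact lcoeff_of_lt y hak n
      refine (mul_eq_zero.1 (?_ : ((n : ℂ) + 1 / 2) * lcoeff y a n = 0)).resolve_left
        (intCast_add_half_ne_zero n)
      have h' := h a n hn
      rcases a with _ | a
      · rw [lcoeff_theta_zero, ih 1 (n - 2) (by omega) (by omega)] at h'
        linear_combination h'
      · rw [lcoeff_theta_succ _ _ _ _ hak, ih a (n - 1) (by omega) (by omega),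
          ih (a + 2) (n - 2) (by omega) (by omega)] at h'
        linear_combination h'
  exact key (n + N + 1).toNat a n hn (by omega)

theorem isRelation_lcoeff (y : Fin (k + 1) → (ℤ →₀ ℂ))
    (h : ∀ (a : ℕ) (n : ℤ), n ≠ 0 → (a = 0 → n < 0 ∨ (m : ℤ) < n) →
      lcoeff (theta k (1 / 2) y) a n = 0) :
    IsRelation k m (lcoeff y) where
  eq_zero_of_lt a n ha := lcoeff_of_lt y ha n
  neg := lcoeff_eq_zero_of_neg y fun a n hn => h a n hn.ne fun _ => .inl hn
  zero n hn hm := by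
    rw [← lcoeff_theta_zero]
    exact h 0 n hn.ne' fun _ => .inr hm
  succ a n ha hn := by
    rw [← lcoeff_theta_succ _ _ _ _ ha]
    exact h (a + 1) n hn.ne' fun h0 => by omega

theorem isCorelation_of_linearMap (φ : (Fin (k + 1) → (ℤ →₀ ℂ)) →ₗ[ℂ] ℂ)
    (hθ : ∀ y, φ (theta k (1 / 2) y) = 0) (hconst : ∀ a, a ≤ k → φ (lmonomial k a 0) = 0)
    (hlow : ∀ n : ℤ, 0 < n → n ≤ m → φ (lmonomial k 0 n) = 0) :
    IsCorelation k m fun a n => φ (lmonomial k a n) where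
  eq_zero_of_lt a n ha := by simp [lmonomial, show ¬ a < k + 1 by omega]
  zero n := by
    have := hθ (lmonomial k 0 n)
    rw [theta_lmonomial_zero] at this
    simpa using this
  succ a n ha := by
    have := hθ (lmonomial k (a + 1) n)
    rw [theta_lmonomial_succ _ _ _ ha] at this
    simpa using this
  const a := by
    rcases lt_or_ge k a with ha | ha
    · simp [lmonomial, show ¬ a < k + 1 by omega]
    · exact hconst a ha
  low n h0 hm := by
    rcases h0.eq_or_lt with rfl | h0
    · exact hconst 0 (Nat.zero_le _)
    · exact hlow n h0 hm

theorem linearMap_eq_zero_of_lmonomial {φ : (Fin (k + 1) → (ℤ →₀ ℂ)) →ₗ[ℂ] ℂ}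
    (h : ∀ (a : ℕ) (n : ℤ), φ (lmonomial k a n) = 0) : φ = 0 := by
  refine LinearMap.pi_ext' fun a => Finsupp.lhom_ext' fun n => LinearMap.ext_ring ?_
  have := h a n
  have he : lmonomial k a n = Pi.single a (Finsupp.single n 1) := by
    unfold lmonomial eL
    rw [dif_pos a.2]
    ext b
    by_cases hb : b = a
    · subst hb; simp
    · simp [hb]
  rw [he] at this
  simpa using this

theorem famL_inl (ρ : ℂ) (i : Fin m) : famL k m ρ (Sum.inl i) =
    (LinearMap.range (theta k ρ)).mkQ (lmonomial k 0 ((i : ℕ) + 1 : ℤ)) := by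
  simp [famL, lmonomial]

theorem famL_inr (ρ : ℂ) (j : Fin (k + 1)) : famL k m ρ (Sum.inr j) =
    (LinearMap.range (theta k ρ)).mkQ (lmonomial k j 0) := by
  simp [famL, lmonomial, j.is_le]

theorem linearIndependent_famL (q : ℕ)
    (hkm : (k = 2 * q + 1 ∧ m = q + 1) ∨ (k = 2 * q ∧ m + 1 = q)) :
    LinearIndependent ℂ (famL k m (1 / 2)) := by
  rw [Fintype.linearIndependent_iff]
  intro c hc
  simp only [Fintype.sum_sum_type, famL_inl, famL_inr, ← map_smul, ← map_sum, ← map_add] at hc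
  rw [Submodule.mkQ_apply, Submodule.Quotient.mk_eq_zero] at hc
  obtain ⟨y, hy⟩ := hc
  have hcoeff (a : ℕ) (n : ℤ) (ha : a ≤ k) : lcoeff (theta k (1 / 2) y) a n =
      (∑ i : Fin m, c (.inl i) * if 0 = a ∧ ((i : ℕ) + 1 : ℤ) = n then 1 else 0)
      + ∑ j : Fin (k + 1), c (.inr j) * if (j : ℕ) = a ∧ (0 : ℤ) = n then 1 else 0 := by
    rw [hy]
    simp only [lcoeff_add, lcoeff_sum, lcoeff_smul, lcoeff_lmonomial _ _ _ _ ha]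
  have hrel : IsRelation k m (lcoeff y) := isRelation_lcoeff y fun a n hn h => by
    rcases lt_or_ge k a with ha | ha
    · exact lcoeff_of_lt _ ha n
    rw [hcoeff a n ha, Finset.sum_eq_zero, Finset.sum_eq_zero, add_zero]
    · intro j _
      rw [if_neg fun h0 => hn h0.2.symm, mul_zero]
    · intro i _
      rw [if_neg, mul_zero]
      rintro ⟨h0, h1⟩
      have := h h0.symm
      omega
  obtain ⟨N, hN⟩ := exists_lcoeff_support_bound y
  have hy0 : y = 0 := lcoeff_ext fun a n _ => by
    rw [hrel.eq_zero q hkm N (fun a n hn => hN a n (hn.trans_le (le_abs_self n))) a n]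
    simp [lcoeff]
  rintro (i | j)
  · have h := hcoeff 0 ((i : ℕ) + 1) (Nat.zero_le _)
    rw [Finset.sum_eq_single i, Finset.sum_eq_zero] at h
    · simpa [hy0, lcoeff] using h.symm
    · intro j _
      rw [if_neg (by omega), mul_zero]
    · intro l _ hl
      rw [if_neg, mul_zero]
      rintro ⟨-, h1⟩
      exact hl (Fin.ext (by omega))
    · simp
  · have h := hcoeff j 0 (by omega)
    rw [Finset.sum_eq_zero, Finset.sum_eq_single j] at h
    · simpa [hy0, lcoeff] using h.symm
    · intro l _ hl
      rw [if_neg, mul_zero]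
      rintro ⟨h1, -⟩
      exact hl (Fin.ext h1)
    · simp
    · intro i _
      rw [if_neg (by omega), mul_zero]

theorem span_famL_eq_top (q : ℕ)
    (hkm : (k = 2 * q + 1 ∧ m = q + 1) ∨ (k = 2 * q ∧ m + 1 = q)) :
    Submodule.span ℂ (Set.range (famL k m (1 / 2))) = ⊤ := by
  by_contra hne
  obtain ⟨ψ, hψ, hker⟩ := Submodule.exists_le_ker_of_lt_top _ (lt_top_iff_ne_top.2 hne)
  have hfam (i) : ψ (famL k m (1 / 2) i) = 0 :=
    hker (Submodule.subset_span (Set.mem_range_self i))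
  set φ := ψ.comp (LinearMap.range (theta k (1 / 2))).mkQ with hφ
  have hcorel : IsCorelation k m fun a n => φ (lmonomial k a n) := by
    refine isCorelation_of_linearMap φ (fun y => ?_) (fun a ha => ?_) fun n h0 hn => ?_
    · rw [hφ, LinearMap.comp_apply, Submodule.mkQ_apply,
        (Submodule.Quotient.mk_eq_zero _).2 (LinearMap.mem_range_self _ y), map_zero]
    · have := hfam (.inr ⟨a, by omega⟩)
      rwa [famL_inr] at this
    · have := hfam (.inl ⟨(n - 1).toNat, by omega⟩)
      rw [famL_inl] at this
      rwa [show (((n - 1).toNat : ℕ) + 1 : ℤ) = n by omega] at this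
  have hφ0 : φ = 0 := linearMap_eq_zero_of_lmonomial fun a n => hcorel.eq_zero q hkm a n
  refine hψ (LinearMap.ext fun x => ?_)
  obtain ⟨y, rfl⟩ := Submodule.mkQ_surjective _ x
  exact LinearMap.congr_fun hφ0 y

end Laurent

/-- For `ρ = 1/2`, the classes of `ω_i⁻ = z^i u_0 dz/z` (`i ∈ I_k`) and `η_j⁻ = u_j dz/z`
(`0 ≤ j ≤ k`), i.e. the classes of the elements `z^i·u_0` (`i ∈ I_k`) and `u_j`
(`0 ≤ j ≤ k`), form a `ℂ`-basis of
`H¹_dR(𝔾_m, L ⊗ Sym^k Ai) = coker(θ_{1/2} : Λ_{1/2} → Λ_{1/2})`,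
where `I_k = {1,…,k′+1}` for `k` odd and `I_k = {1,…,k′}` for `k` even. -/
theorem stmt_13 (k k' : ℕ) (hk : 1 ≤ k) (hk' : k' = (k - 1) / 2) :
    LinearIndependent ℂ (famL k (if Odd k then k' + 1 else k') (1 / 2))
    ∧ Submodule.span ℂ (Set.range (famL k (if Odd k then k' + 1 else k') (1 / 2))) = ⊤ := by
  obtain ⟨q, hkm⟩ : ∃ q, (k = 2 * q + 1 ∧ (if Odd k then k' + 1 else k') = q + 1) ∨
      (k = 2 * q ∧ (if Odd k then k' + 1 else k') + 1 = q) := by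
    rcases Nat.even_or_odd' k with ⟨q, h | h⟩
    · have hodd : ¬ Odd k := by rw [Nat.not_odd_iff_even, h]; exact even_two_mul q
      exact ⟨q, .inr ⟨h, by rw [if_neg hodd]; omega⟩⟩
    · have hodd : Odd k := ⟨q, h⟩
      exact ⟨q, .inl ⟨h, by rw [if_pos hodd]; omega⟩⟩
  exact ⟨linearIndependent_famL q hkm, span_famL_eq_top q hkm⟩
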